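/- arXiv:1304.5659 — 2 statements merged into one kernel-verified Lean document; each statement's English description precedes it below -/
import Mathlib

section
/- Let ε : ℕ → ℝ with ε i ∈ {-1, 1} for all i ≥ 1 and set r = lim_{n→∞} r_n. Then ε is eventually periodic (there exist k ≥ 1 and p ≥ 1 with ε_{i+p} = ε_i for all i ≥ k) if and only if r = 2·cos(q·π) for some rational q with 0 ≤ q ≤ 1/2 (and for r ∈ (0,2), with 0 < q < 1/2). -/
open Filter Real

/-- The nested radical `r_n(c) = √(2 + ε₁√(2 + ε₂√(2 + ⋯ + ε_n√(2 + c))))`,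
defined by the recursion `r₀(c) = √(2 + c)`, `r_n(c) = r_{n-1}(ε_n √(2 + c))`;
`r_n = r_n(0)` is the nested radical of 2. -/
noncomputable def nest (ε : ℕ → ℝ) : ℕ → ℝ → ℝ
  | 0, c => Real.sqrt (2 + c)
  | n + 1, c => nest ε n (ε (n + 1) * Real.sqrt (2 + c))

lemma nest_succ_eq_sqrt (ε : ℕ → ℝ) (n : ℕ) (c : ℝ) :
    nest ε (n + 1) c = √(2 + ε 1 * nest (fun i => ε (i + 1)) n c) := by
  induction n generalizing c with
  | zero => rfl
  | succ n ih =>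
    change nest ε (n + 1) (ε (n + 2) * √(2 + c)) = _
    rw [ih]
    rfl

lemma nest_mem_Icc (ε : ℕ → ℝ) (hε : ∀ i, 1 ≤ i → ε i = 1 ∨ ε i = -1) (n : ℕ) (c : ℝ)
    (hc : c ∈ Set.Icc (-2 : ℝ) 2) : nest ε n c ∈ Set.Icc (0 : ℝ) 2 := by
  have hsqrt : √(2 + c) ≤ 2 := Real.sqrt_le_iff.2 ⟨by norm_num, by linarith [hc.2]⟩
  have hnonneg := Real.sqrt_nonneg (2 + c)
  induction n generalizing c with
  | zero => exact ⟨hnonneg, hsqrt⟩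
  | succ n ih =>
    have hmem : ε (n + 1) * √(2 + c) ∈ Set.Icc (-2 : ℝ) 2 := by
      rcases hε (n + 1) (by omega) with h | h <;> rw [h] <;> constructor <;> linarith
    exact ih _ hmem (Real.sqrt_le_iff.2 ⟨by norm_num, by linarith [hmem.2]⟩)
      (Real.sqrt_nonneg _)

/-- If a continued radical converges, so does the radical obtained by dropping its first sign. -/
lemma exists_tendsto_nest_shift (ε : ℕ → ℝ) (hε : ∀ i, 1 ≤ i → ε i = 1 ∨ ε i = -1) (r : ℝ)
    (hlim : Tendsto (fun n => nest ε n 0) atTop (nhds r)) :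
    ∃ s, Tendsto (fun n => nest (fun i => ε (i + 1)) n 0) atTop (nhds s) ∧
      r ^ 2 = 2 + ε 1 * s := by
  have hsq : ε 1 * ε 1 = 1 := by rcases hε 1 le_rfl with h | h <;> rw [h] <;> norm_num
  refine ⟨ε 1 * (r ^ 2 - 2), ?_, by linear_combination (2 - r ^ 2) * hsq⟩
  have hlim' := (((hlim.comp (tendsto_add_atTop_nat 1)).pow 2).sub_const 2).const_mul (ε 1)
  refine hlim'.congr fun n => ?_
  obtain ⟨h0, h2⟩ := nest_mem_Icc (fun i => ε (i + 1)) (fun i _ => hε (i + 1) (by omega)) n 0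
    (by norm_num)
  simp only [Function.comp_apply, nest_succ_eq_sqrt]
  rw [Real.sq_sqrt]
  · linear_combination nest (fun i => ε (i + 1)) n 0 * hsq
  · rcases hε 1 le_rfl with h | h <;> rw [h] <;> linarith

lemma exists_tendsto_nest_tails (ε : ℕ → ℝ) (hε : ∀ i, 1 ≤ i → ε i = 1 ∨ ε i = -1) (r : ℝ)
    (hlim : Tendsto (fun n => nest ε n 0) atTop (nhds r)) :
    ∃ R : ℕ → ℝ, R 0 = r ∧
      (∀ k, Tendsto (fun n => nest (fun i => ε (i + k)) n 0) atTop (nhds (R k))) ∧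
      (∀ k, R k ∈ Set.Icc (0 : ℝ) 2) ∧ ∀ k, R k ^ 2 = 2 + ε (k + 1) * R (k + 1) := by
  have hshift (k : ℕ) (i : ℕ) (hi : 1 ≤ i) : ε (i + k) = 1 ∨ ε (i + k) = -1 :=
    hε (i + k) (by omega)
  have hstep (k : ℕ) (s : ℝ)
      (hs : Tendsto (fun n => nest (fun i => ε (i + k)) n 0) atTop (nhds s)) :
      ∃ t, Tendsto (fun n => nest (fun i => ε (i + (k + 1))) n 0) atTop (nhds t) ∧
        s ^ 2 = 2 + ε (k + 1) * t := by
    simpa only [add_assoc, add_comm 1 k] using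
      exists_tendsto_nest_shift (fun i => ε (i + k)) (hshift k) s hs
  have hex (k : ℕ) :
      ∃ s, Tendsto (fun n => nest (fun i => ε (i + k)) n 0) atTop (nhds s) := by
    induction k with
    | zero => exact ⟨r, hlim⟩
    | succ k ih =>
      obtain ⟨s, hs⟩ := ih
      obtain ⟨t, ht, -⟩ := hstep k s hs
      exact ⟨t, ht⟩
  choose R hR using hex
  refine ⟨R, tendsto_nhds_unique (hR 0) hlim, hR, fun k => ?_, fun k => ?_⟩
  · exact isClosed_Icc.mem_of_tendsto (hR k)
      (Eventually.of_forall fun n => nest_mem_Icc _ (hshift k) n 0 (by norm_num))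
  · obtain ⟨t, ht, hst⟩ := hstep k (R k) (hR k)
    rwa [tendsto_nhds_unique (hR (k + 1)) ht]

lemma angle_step {e θ φ : ℝ} (he : e = 1 ∨ e = -1) (hθ : θ ∈ Set.Icc 0 (π / 2))
    (hφ : φ ∈ Set.Icc 0 (π / 2)) (h : (2 * cos θ) ^ 2 = 2 + e * (2 * cos φ)) :
    φ = 2 * θ ∨ φ = π - 2 * θ := by
  have hcos : cos (2 * θ) = e * cos φ := by
    rw [Real.cos_two_mul]
    linarith
  have hdouble : 2 * θ ∈ Set.Icc 0 π := ⟨by linarith [hθ.1], by linarith [hθ.2]⟩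
  have hpi := Real.pi_pos
  rcases he with rfl | rfl
  · left
    exact Real.injOn_cos ⟨hφ.1, by linarith [hφ.2]⟩ hdouble (by linarith)
  · right
    have := Real.injOn_cos (x₁ := π - φ) ⟨by linarith [hφ.2], by linarith [hφ.1]⟩ hdouble
      (by rw [Real.cos_pi_sub]; linarith)
    linarith

lemma exists_angles (ε R : ℕ → ℝ) (hε : ∀ i, 1 ≤ i → ε i = 1 ∨ ε i = -1)
    (hR : ∀ k, R k ∈ Set.Icc (0 : ℝ) 2) (hrec : ∀ k, R k ^ 2 = 2 + ε (k + 1) * R (k + 1)) :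
    ∃ θ : ℕ → ℝ, (∀ k, θ k = arccos (R k / 2)) ∧ (∀ k, R k = 2 * cos (θ k)) ∧
      (∀ k, θ k ∈ Set.Icc 0 (π / 2)) ∧
      ∀ k, θ (k + 1) = 2 * θ k ∨ θ (k + 1) = π - 2 * θ k := by
  have hcos (k : ℕ) : R k = 2 * cos (arccos (R k / 2)) := by
    rw [Real.cos_arccos (by linarith [(hR k).1]) (by linarith [(hR k).2])]
    ring
  have hmem (k : ℕ) : arccos (R k / 2) ∈ Set.Icc 0 (π / 2) :=
    ⟨Real.arccos_nonneg _, Real.arccos_le_pi_div_two.2 (by linarith [(hR k).1])⟩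
  refine ⟨fun k => arccos (R k / 2), fun _ => rfl, hcos, hmem, fun k => ?_⟩
  refine angle_step (hε (k + 1) (by omega)) (hmem k) (hmem (k + 1)) ?_
  rw [← hcos, ← hcos]
  exact hrec k

lemma angle_add (θ : ℕ → ℝ)
    (hθ : ∀ k, θ (k + 1) = 2 * θ k ∨ θ (k + 1) = π - 2 * θ k) (k n : ℕ) :
    ∃ a b : ℤ, |b| = 2 ^ n ∧ θ (k + n) = a * π + b * θ k := by
  induction n with
  | zero => exact ⟨0, 1, by simp, by simp⟩
  | succ n ih =>
    obtain ⟨a, b, hb, h⟩ := ih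
    rcases hθ (k + n) with h' | h'
    · refine ⟨2 * a, 2 * b, by rw [abs_mul, hb, pow_succ']; norm_num, ?_⟩
      rw [← add_assoc, h', h]
      push_cast
      ring
    · refine ⟨1 - 2 * a, -2 * b, by rw [abs_mul, hb, pow_succ']; norm_num, ?_⟩
      rw [← add_assoc, h', h]
      push_cast
      ring

lemma exists_rat_mul_pi_of_angle_eq (θ : ℕ → ℝ)
    (hθ : ∀ k, θ (k + 1) = 2 * θ k ∨ θ (k + 1) = π - 2 * θ k) {k p : ℕ} (hp : 1 ≤ p)
    (h : θ (k + p) = θ k) : ∃ q : ℚ, θ 0 = q * π := by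
  obtain ⟨a, b, hb, hab⟩ := angle_add θ hθ k p
  obtain ⟨c, d, hd, hcd⟩ := angle_add θ hθ 0 k
  have hb1 : (1 - b : ℝ) ≠ 0 := by
    intro h1
    have h1' : b = 1 := by
      have : (b : ℝ) = 1 := by linarith
      exact_mod_cast this
    rw [h1', abs_one] at hb
    have := one_lt_pow₀ (one_lt_two : (1 : ℤ) < 2) (by omega : p ≠ 0)
    omega
  have hd0 : (d : ℝ) ≠ 0 := by
    intro h0
    have h0' : d = 0 := by exact_mod_cast h0
    rw [h0', abs_zero] at hd
    have : (0 : ℤ) < 2 ^ k := by positivity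
    omega
  refine ⟨(a / (1 - b) - c) / d, ?_⟩
  rw [zero_add] at hcd
  push_cast
  field_simp
  linear_combination hab - h - (1 - b : ℝ) * hcd

lemma exists_angle_eq_of_rat (θ : ℕ → ℝ) (hmem : ∀ k, θ k ∈ Set.Icc 0 (π / 2))
    (hθ : ∀ k, θ (k + 1) = 2 * θ k ∨ θ (k + 1) = π - 2 * θ k) (q : ℚ) (hq : θ 0 = q * π) :
    ∃ i p : ℕ, 1 ≤ p ∧ θ (i + p) = θ i := by
  have hd : (0 : ℝ) < q.den := by exact_mod_cast q.den_pos
  have hpi := Real.pi_pos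
  have hm (k : ℕ) : ∃ m : ℤ, θ k * q.den = m * π := by
    obtain ⟨a, b, -, hab⟩ := angle_add θ hθ 0 k
    have hqd : (q : ℝ) * q.den = q.num := by exact_mod_cast Rat.mul_den_eq_num q
    refine ⟨a * q.den + b * q.num, ?_⟩
    rw [zero_add] at hab
    rw [hab, hq]
    push_cast
    linear_combination (b : ℝ) * π * hqd
  choose m hm using hm
  have hbound (k : ℕ) : m k ∈ Set.Icc (0 : ℤ) q.den := by
    obtain ⟨h0, h1⟩ := hmem k
    have hk := hm k
    constructor
    · have : (0 : ℝ) ≤ m k := by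
        refine nonneg_of_mul_nonneg_left (b := π) ?_ hpi
        rw [← hk]
        positivity
      exact_mod_cast this
    · have : (m k : ℝ) ≤ q.den := by
        refine le_of_mul_le_mul_right ?_ hpi
        rw [← hk, mul_comm (q.den : ℝ)]
        exact mul_le_mul_of_nonneg_right (by linarith) hd.le
      exact_mod_cast this
  obtain ⟨i, j, hij, heq⟩ := (Set.finite_Icc (0 : ℤ) q.den).exists_lt_map_eq_of_forall_mem hbound
  refine ⟨i, j - i, by omega, ?_⟩
  rw [Nat.add_sub_cancel' hij.le]
  refine mul_right_cancel₀ hd.ne' ?_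
  rw [hm, hm, heq]

lemma sign_eq_one_of_eq_two (ε R : ℕ → ℝ) (hε : ∀ i, 1 ≤ i → ε i = 1 ∨ ε i = -1)
    (hR : ∀ k, R k ∈ Set.Icc (0 : ℝ) 2) (hrec : ∀ k, R k ^ 2 = 2 + ε (k + 1) * R (k + 1))
    {k : ℕ} (hk : R k = 2) : ∀ i, k + 1 ≤ i → ε i = 1 := by
  have hstep (j : ℕ) (hj : R j = 2) : ε (j + 1) = 1 ∧ R (j + 1) = 2 := by
    have h := hrec j
    rw [hj] at h
    rcases hε (j + 1) (by omega) with h' | h' <;> rw [h'] at h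
    · exact ⟨h', by linarith⟩
    · linarith [(hR (j + 1)).1]
  have htwo (j : ℕ) (hj : k ≤ j) : R j = 2 := by
    induction j, hj using Nat.le_induction with
    | base => exact hk
    | succ j _ ih => exact (hstep j ih).2
  intro i hi
  obtain ⟨j, rfl⟩ := Nat.exists_eq_add_of_le' (show 1 ≤ i by omega)
  exact (hstep j (htwo j (by omega))).1

lemma eventually_periodic_of_value_eq (ε R : ℕ → ℝ) (hε : ∀ i, 1 ≤ i → ε i = 1 ∨ ε i = -1)
    (hR : ∀ k, R k ∈ Set.Icc (0 : ℝ) 2) (hrec : ∀ k, R k ^ 2 = 2 + ε (k + 1) * R (k + 1))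
    {i p : ℕ} (hp : 1 ≤ p) (h : R (i + p) = R i) :
    ∃ k p : ℕ, 1 ≤ k ∧ 1 ≤ p ∧ ∀ i, k ≤ i → ε (i + p) = ε i := by
  by_cases hzero : ∃ k, R k = 0
  · obtain ⟨k, hk⟩ := hzero
    have htwo : R (k + 1) = 2 := by
      have h0 := hrec k
      rw [hk] at h0
      rcases hε (k + 1) (by omega) with h' | h' <;> rw [h'] at h0 <;>
        linarith [(hR (k + 1)).1]
    have hone := sign_eq_one_of_eq_two ε R hε hR hrec htwo
    exact ⟨k + 2, 1, by omega, le_rfl, fun j hj => by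
      rw [hone j (by omega), hone (j + 1) (by omega)]⟩
  · push Not at hzero
    have hpos (k : ℕ) : 0 < R k := (hR k).1.lt_of_ne' (hzero k)
    have hstep (j : ℕ) (hj : R (j + p) = R j) :
        ε (j + 1 + p) = ε (j + 1) ∧ R (j + 1 + p) = R (j + 1) := by
      have h1 := hrec (j + p)
      rw [hj, hrec j, add_right_comm] at h1
      have h2 := hpos (j + 1)
      have h3 := hpos (j + 1 + p)
      rcases hε (j + 1) (by omega) with ha | ha <;>
        rcases hε (j + 1 + p) (by omega) with hb | hb <;> rw [ha, hb] at h1 ⊢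
      · exact ⟨rfl, by linarith⟩
      · linarith
      · linarith
      · exact ⟨rfl, by linarith⟩
    have hval (j : ℕ) (hj : i ≤ j) : R (j + p) = R j := by
      induction j, hj using Nat.le_induction with
      | base => exact h
      | succ j _ ih => exact (hstep j ih).2
    refine ⟨i + 1, p, by omega, hp, fun l hl => ?_⟩
    obtain ⟨j, rfl⟩ := Nat.exists_eq_add_of_le' (show 1 ≤ l by omega)
    exact (hstep j (hval j (by omega))).1

lemma eventually_periodic_iff_exists_rat (ε : ℕ → ℝ)
    (hε : ∀ i, 1 ≤ i → ε i = 1 ∨ ε i = -1) (r : ℝ)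
    (hlim : Tendsto (fun n => nest ε n 0) atTop (nhds r)) :
    (∃ k p : ℕ, 1 ≤ k ∧ 1 ≤ p ∧ ∀ i, k ≤ i → ε (i + p) = ε i) ↔
      ∃ q : ℚ, 0 ≤ q ∧ q ≤ 1 / 2 ∧ r = 2 * Real.cos (q * π) := by
  obtain ⟨R, rfl, htends, hR, hrec⟩ := exists_tendsto_nest_tails ε hε r hlim
  obtain ⟨θ, hθR, hRθ, hmem, hstep⟩ := exists_angles ε R hε hR hrec
  have hpi := Real.pi_pos
  constructor
  · rintro ⟨k, p, -, hp, hper⟩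
    have hRk : R (k + p) = R k := by
      have htail : (fun i => ε (i + (k + p))) = fun i => ε (i + k) := by
        funext i
        rw [← add_assoc, hper (i + k) (by omega)]
      have := htends (k + p)
      rw [htail] at this
      exact tendsto_nhds_unique this (htends k)
    obtain ⟨q, hq⟩ := exists_rat_mul_pi_of_angle_eq θ hstep hp (by rw [hθR, hθR, hRk])
    obtain ⟨h0, h1⟩ := hmem 0
    rw [hq] at h0 h1
    refine ⟨q, ?_, ?_, by rw [← hq, hRθ]⟩
    · have : (0 : ℝ) ≤ q := nonneg_of_mul_nonneg_left h0 hpi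
      exact_mod_cast this
    · have : (q : ℝ) ≤ ((1 / 2 : ℚ) : ℝ) := by
        push_cast
        exact le_of_mul_le_mul_right (by linarith) hpi
      exact_mod_cast this
  · rintro ⟨q, hq0, hq1, hq⟩
    have hq0' : (0 : ℝ) ≤ q := by exact_mod_cast hq0
    have hq1' : (q : ℝ) ≤ 1 := by exact_mod_cast hq1.trans (by norm_num)
    have hθ0 : θ 0 = q * π := by
      rw [hθR, hq, mul_div_cancel_left₀ _ two_ne_zero]
      exact Real.arccos_cos (by positivity) (by nlinarith)
    obtain ⟨i, p, hp, hip⟩ := exists_angle_eq_of_rat θ hmem hstep q hθ0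
    exact eventually_periodic_of_value_eq ε R hε hR hrec hp (by rw [hRθ, hRθ, hip])

/-- Corollary 4.1: the continued radical is eventually periodic iff its value
`r = lim r_n` equals `2 cos(qπ)` for some rational `q ∈ [0, 1/2]`; moreover when
`r ∈ (0, 2)` one may take `q ∈ (0, 1/2)`. -/
theorem eventually_periodic_iff (ε : ℕ → ℝ)
    (hε : ∀ i, 1 ≤ i → ε i = 1 ∨ ε i = -1) (r : ℝ)
    (hlim : Filter.Tendsto (fun n => nest ε n 0) Filter.atTop (nhds r)) :
    ((∃ k p : ℕ, 1 ≤ k ∧ 1 ≤ p ∧ ∀ i, k ≤ i → ε (i + p) = ε i) ↔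
      ∃ q : ℚ, 0 ≤ q ∧ q ≤ 1 / 2 ∧ r = 2 * Real.cos (q * π)) ∧
    (r ∈ Set.Ioo (0 : ℝ) 2 →
      ((∃ k p : ℕ, 1 ≤ k ∧ 1 ≤ p ∧ ∀ i, k ≤ i → ε (i + p) = ε i) ↔
        ∃ q : ℚ, 0 < q ∧ q < 1 / 2 ∧ r = 2 * Real.cos (q * π))) := by
  have hiff := eventually_periodic_iff_exists_rat ε hε r hlim
  refine ⟨hiff, fun hr => hiff.trans ⟨?_, ?_⟩⟩
  · rintro ⟨q, hq0, hq1, rfl⟩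
    refine ⟨q, hq0.lt_of_ne ?_, hq1.lt_of_ne ?_, rfl⟩
    · rintro rfl
      simp at hr
    · rintro rfl
      have hcos : cos (((1 / 2 : ℚ) : ℝ) * π) = 0 := by
        rw [← Real.cos_pi_div_two]
        congr 1
        push_cast
        ring
      rw [hcos, mul_zero] at hr
      exact hr.1.false
  · rintro ⟨q, hq0, hq1, hq⟩
    exact ⟨q, hq0.le, hq1.le, hq⟩
end

section
/- Let ε : ℕ → ℝ with ε i ∈ {-1, 1} for all i ≥ 1 be totally periodic with period p ≥ 1, and suppose δ_p = ε₁ε₂⋯ε_p = 1. Then for all m ≥ 0 and 0 ≤ j ≤ p−1, r_{mp+j} = 2·cos((1 − 2^p σ_p/(2^p − 1) + (1/2^{mp})·2^p σ_p/(2^p − 1) − σ_j/2^{mp})·π/4), where σ_j = Σ_{i=1}^j δ_i/2^i (with σ_0 = 0) and δ_i = ε₁ε₂⋯ε_i. -/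
open Filter Real

/-- `δ_i = ε₁ε₂⋯ε_i`, with `δ_0 = 1` (empty product). -/
noncomputable def del (ε : ℕ → ℝ) (i : ℕ) : ℝ := ∏ j ∈ Finset.Icc 1 i, ε j

/-- `σ_j = Σ_{i=1}^j δ_i / 2^i`, with `σ_0 = 0`. -/
noncomputable def sig (ε : ℕ → ℝ) (j : ℕ) : ℝ :=
  ∑ i ∈ Finset.Icc 1 j, del ε i / 2 ^ i

theorem del_succ (ε : ℕ → ℝ) (n : ℕ) : del ε (n + 1) = del ε n * ε (n + 1) := by
  simp [del, Finset.prod_Icc_succ_top]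

theorem sig_succ (ε : ℕ → ℝ) (n : ℕ) :
    sig ε (n + 1) = sig ε n + del ε (n + 1) / 2 ^ (n + 1) := by
  simp [sig, Finset.sum_Icc_succ_top]

theorem sqrt_two_add_two_mul_cos {φ : ℝ} (h0 : 0 ≤ φ) (h1 : φ ≤ π) :
    √(2 + 2 * cos φ) = 2 * cos (φ / 2) := by
  have hc : 0 ≤ cos (φ / 2) := cos_nonneg_of_mem_Icc ⟨by linarith [pi_pos], by linarith⟩
  have h : cos φ = 2 * cos (φ / 2) ^ 2 - 1 := by rw [← cos_two_mul]; ring_nf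
  rw [h, show 2 + 2 * (2 * cos (φ / 2) ^ 2 - 1) = (2 * cos (φ / 2)) ^ 2 by ring]
  exact sqrt_sq (by positivity)

theorem nest_two_mul_cos {ε : ℕ → ℝ} (hε : ∀ i, 1 ≤ i → ε i = 1 ∨ ε i = -1) (n : ℕ) {y : ℝ}
    (h0 : -1 ≤ y) (h1 : y ≤ 1) :
    nest ε n (2 * cos ((1 - y) * (π / 2))) =
      2 * cos ((1 - sig ε n - del ε n * y / 2 ^ n) * (π / 4)) := by
  have hpi := pi_pos
  have hsqrt : ∀ {y : ℝ}, -1 ≤ y → y ≤ 1 →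
      √(2 + 2 * cos ((1 - y) * (π / 2))) = 2 * cos ((1 - y) * (π / 4)) := by
    intro y h0 h1
    rw [sqrt_two_add_two_mul_cos (by nlinarith) (by nlinarith)]
    ring_nf
  induction n generalizing y with
  | zero => simp [nest, hsqrt h0 h1, sig, del]
  | succ n ih =>
    have hstep : ε (n + 1) * √(2 + 2 * cos ((1 - y) * (π / 2))) =
        2 * cos ((1 - ε (n + 1) * (1 + y) / 2) * (π / 2)) := by
      rw [hsqrt h0 h1]
      rcases hε (n + 1) (by omega) with h | h <;> rw [h]
      · ring_nf
      · rw [show (1 - -1 * (1 + y) / 2) * (π / 2) = π - (1 - y) * (π / 4) by ring, cos_pi_sub]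
        ring
    rw [nest, hstep, ih, sig_succ, del_succ]
    · congr 2
      field_simp
      ring
    · rcases hε (n + 1) (by omega) with h | h <;> rw [h] <;> linarith
    · rcases hε (n + 1) (by omega) with h | h <;> rw [h] <;> linarith

theorem nest_zero {ε : ℕ → ℝ} (hε : ∀ i, 1 ≤ i → ε i = 1 ∨ ε i = -1) (n : ℕ) :
    nest ε n 0 = 2 * cos ((1 - sig ε n) * (π / 4)) := by
  simpa using nest_two_mul_cos hε n (y := 0) (by norm_num) (by norm_num)

theorem del_add_period {ε : ℕ → ℝ} {p : ℕ} (hper : ∀ i, 1 ≤ i → ε (i + p) = ε i) (n : ℕ) :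
    del ε (p + n) = del ε p * del ε n := by
  induction n with
  | zero => simp [del]
  | succ n ih =>
    rw [← add_assoc, del_succ, ih, del_succ, ← hper (n + 1) (by omega),
      show p + n + 1 = n + 1 + p by omega, mul_assoc]

theorem sig_add_period {ε : ℕ → ℝ} {p : ℕ} (hper : ∀ i, 1 ≤ i → ε (i + p) = ε i) (n : ℕ) :
    sig ε (p + n) = sig ε p + del ε p * sig ε n / 2 ^ p := by
  induction n with
  | zero => simp [sig]
  | succ n ih =>
    rw [← add_assoc, sig_succ, ih, sig_succ, add_assoc p n 1, del_add_period hper]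
    field_simp
    ring

theorem sig_mul_period_add {ε : ℕ → ℝ} {p : ℕ} (hp : 1 ≤ p)
    (hper : ∀ i, 1 ≤ i → ε (i + p) = ε i) (hδ : del ε p = 1) (m j : ℕ) :
    sig ε (m * p + j) = 2 ^ p * sig ε p / (2 ^ p - 1)
      - (1 / 2 ^ (m * p)) * (2 ^ p * sig ε p / (2 ^ p - 1)) + sig ε j / 2 ^ (m * p) := by
  have hne : (2 : ℝ) ^ p - 1 ≠ 0 :=
    (sub_pos.2 (one_lt_pow₀ one_lt_two (by omega))).ne'
  induction m with
  | zero => simp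
  | succ m ih =>
    rw [show (m + 1) * p + j = p + (m * p + j) by ring, sig_add_period hper, ih, hδ,
      show (m + 1) * p = p + m * p by ring, pow_add]
    field_simp
    ring

/-- Theorem 5, case `δ_p = 1`: closed form of `r_{mp+j}` for a totally periodic
sign sequence of period `p`. -/
theorem nest_periodic_closed_form_pos (ε : ℕ → ℝ)
    (hε : ∀ i, 1 ≤ i → ε i = 1 ∨ ε i = -1)
    (p : ℕ) (hp : 1 ≤ p) (hper : ∀ i, 1 ≤ i → ε (i + p) = ε i)
    (hδ : del ε p = 1) (m j : ℕ) (hj : j ≤ p - 1) :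
    nest ε (m * p + j) 0 = 2 * Real.cos
      ((1 - 2 ^ p * sig ε p / (2 ^ p - 1)
        + (1 / 2 ^ (m * p)) * (2 ^ p * sig ε p / (2 ^ p - 1))
        - sig ε j / 2 ^ (m * p)) * (π / 4)) := by
  rw [nest_zero hε, sig_mul_period_add hp hper hδ]
  ring_nf
end
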